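/- Let I ⊂ E be a homogeneous ideal. For each d-element subset τ of [n], the rank of the matrix M_τ(I,d) is independent of the choice of φ ∈ GL(n;K) satisfying Gin^E(I) = in_{<rev}(φ(I)) and of the choice of K-basis f_1,…,f_s of I_d. -/

import Mathlib

/-- The exterior algebra `E = ⋀ V` of an `n`-dimensional `K`-vector space `V`
with distinguished basis `e_1, …, e_n` (modeled on `V = Fin n → K`). -/
abbrev ExtAlg (K : Type) [Field K] (n : ℕ) := ExteriorAlgebra K (Fin n → K)

/-- The monomial `e_σ = e_{j_1} ∧ ⋯ ∧ e_{j_d}` for `σ = {j_1 < ⋯ < j_d} ⊆ [n]`. -/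
noncomputable def eMon (K : Type) [Field K] (n : ℕ) (σ : Finset (Fin n)) : ExtAlg K n :=
  ((σ.sort (· ≤ ·)).map fun k => ExteriorAlgebra.ι K (Pi.single k (1 : K))).prod

/-- The span of the degree-`d` monomials: the image of `⋀^d V` in `E`. -/
noncomputable def monSpan (K : Type) [Field K] (n : ℕ) (d : ℕ) :
    Submodule K (ExtAlg K n) :=
  Submodule.span K {x | ∃ σ : Finset (Fin n), σ.card = d ∧ x = eMon K n σ}

/-- A subspace of `E` is a (two-sided) ideal. -/
def IsIdealE {K : Type} [Field K] {n : ℕ} (I : Submodule K (ExtAlg K n)) : Prop :=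
  ∀ x y : ExtAlg K n, y ∈ I → x * y ∈ I ∧ y * x ∈ I

/-- A subspace of `E` is (graded) homogeneous. -/
def IsHomogE {K : Type} [Field K] {n : ℕ} (I : Submodule K (ExtAlg K n)) : Prop :=
  I = ⨆ d : ℕ, I ⊓ monSpan K n d

/-- The two-sided ideal of `E` generated by a set. -/
noncomputable def idealSpanE (K : Type) [Field K] (n : ℕ) (s : Set (ExtAlg K n)) :
    Submodule K (ExtAlg K n) :=
  Submodule.span K {x | ∃ a ∈ s, ∃ u v : ExtAlg K n, x = u * a * v}

/-- The exterior face ideal `J_Δ ⊆ E`, generated by the monomials `e_σ`, `σ ∉ Δ`. -/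
noncomputable def faceIdealE (K : Type) [Field K] {n : ℕ} (Δ : Set (Finset (Fin n))) :
    Submodule K (ExtAlg K n) :=
  idealSpanE K n {x | ∃ σ : Finset (Fin n), σ ∉ Δ ∧ x = eMon K n σ}

/-- `e_τ ≤_rev e_σ` in the reverse lexicographic order induced by `e_1 > ⋯ > e_n`:
either `τ = σ`, or the largest element of the symmetric difference belongs to `τ`. -/
def revLexLe {n : ℕ} (τ σ : Finset (Fin n)) : Prop :=
  τ = σ ∨ ∃ k ∈ τ, k ∉ σ ∧ ∀ l ∈ σ, l ∉ τ → l < k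

/-- The span of the monomials `e_ρ` of degree `|σ|` with `e_ρ ≤_rev e_σ`. -/
noncomputable def monSpanLe (K : Type) [Field K] {n : ℕ} (σ : Finset (Fin n)) :
    Submodule K (ExtAlg K n) :=
  Submodule.span K
    {x | ∃ ρ : Finset (Fin n), ρ.card = σ.card ∧ revLexLe ρ σ ∧ x = eMon K n ρ}

/-- The span of the monomials `e_ρ` of degree `|σ|` with `e_ρ <_rev e_σ`. -/
noncomputable def monSpanLt (K : Type) [Field K] {n : ℕ} (σ : Finset (Fin n)) :
    Submodule K (ExtAlg K n) :=
  Submodule.span K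
    {x | ∃ ρ : Finset (Fin n), ρ.card = σ.card ∧ revLexLe ρ σ ∧ ρ ≠ σ ∧ x = eMon K n ρ}

/-- `e_σ` is the initial monomial (with respect to `<_rev`) of some element of `I`. -/
def IsInitialMonomial {K : Type} [Field K] {n : ℕ} (I : Submodule K (ExtAlg K n))
    (σ : Finset (Fin n)) : Prop :=
  ∃ f ∈ I, f ∈ monSpanLe K σ ∧ f ∉ monSpanLt K σ ∧ f ≠ 0

/-- The initial ideal `in_{<rev}(I)` of a homogeneous ideal `I ⊆ E`. -/
noncomputable def initialIdealE (K : Type) [Field K] {n : ℕ}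
    (I : Submodule K (ExtAlg K n)) : Submodule K (ExtAlg K n) :=
  Submodule.span K {x | ∃ σ : Finset (Fin n), IsInitialMonomial I σ ∧ x = eMon K n σ}

/-- The algebra automorphism of `E` induced by an (invertible) matrix `g`,
i.e. the action of `GL(n;K)` on `E`. -/
noncomputable def matAlgMap (K : Type) [Field K] {n : ℕ} (g : Matrix (Fin n) (Fin n) K) :
    ExtAlg K n →ₐ[K] ExtAlg K n :=
  ExteriorAlgebra.map (Matrix.toLin' g)

/-- The image `φ(I)` of a subspace `I ⊆ E` under the action of a matrix `φ = g`. -/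
noncomputable def applyMat (K : Type) [Field K] {n : ℕ} (g : Matrix (Fin n) (Fin n) K)
    (I : Submodule K (ExtAlg K n)) : Submodule K (ExtAlg K n) :=
  Submodule.map (matAlgMap K g).toLinearMap I

/-- `J` is the generic initial ideal `Gin^E(I)` of `I`: there is a nonempty Zariski
open subset `U` of `GL(n;K)` (the nonvanishing locus of a nonzero polynomial in the
matrix entries) such that `in_{<rev}(φ(I)) = J` for every `φ ∈ U`. -/
def IsGinE {K : Type} [Field K] {n : ℕ} (I J : Submodule K (ExtAlg K n)) : Prop :=
  ∃ p : MvPolynomial (Fin n × Fin n) K, p ≠ 0 ∧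
    ∀ g : Matrix (Fin n) (Fin n) K, IsUnit g.det →
      MvPolynomial.eval (fun kl => g kl.1 kl.2) p ≠ 0 →
        initialIdealE K (applyMat K g I) = J

/-- `m_{≤i}(J, d)`: the number of monomials `e_σ ∈ J` of degree `d` with
`m(e_σ) = max σ ≤ i` (in the `1`-based labelling `[n] = {1, …, n}`). -/
noncomputable def mLeE {K : Type} [Field K] {n : ℕ} (J : Submodule K (ExtAlg K n))
    (i d : ℕ) : ℕ :=
  Nat.card {σ : Finset (Fin n) // σ.card = d ∧ (∀ k ∈ σ, (k : ℕ) < i) ∧ eMon K n σ ∈ J}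

open Classical in
/-- The matrix `M_τ(I,d)`: the submatrix of `M(I,d) = (α_a^σ)` consisting of the
columns indexed by the `d`-element subsets `σ` with `e_τ ≤_rev e_σ` (realized by
zeroing out all other columns, which does not change the rank). -/
noncomputable def MtauMatrix {K : Type} [Field K] {n : ℕ} {s : ℕ}
    (α : Fin s → Finset (Fin n) → K) (d : ℕ) (τ : Finset (Fin n)) :
    Matrix (Fin s) (Finset (Fin n)) K :=
  Matrix.of fun a σ => if σ.card = d ∧ τ.card = d ∧ revLexLe τ σ then α a σ else 0

open Classical in
/-- The matrix `M'_τ(I,d)`: the submatrix of `M_τ(I,d)` obtained by removing the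
column indexed by `τ` (realized by zeroing out all other columns). -/
noncomputable def MtauMatrix' {K : Type} [Field K] {n : ℕ} {s : ℕ}
    (α : Fin s → Finset (Fin n) → K) (d : ℕ) (τ : Finset (Fin n)) :
    Matrix (Fin s) (Finset (Fin n)) K :=
  Matrix.of fun a σ =>
    if σ.card = d ∧ τ.card = d ∧ revLexLe τ σ ∧ σ ≠ τ then α a σ else 0

/-- `f : Fin s → E` is a `K`-basis of the degree-`d` part `I_d = I ⊓ ⋀^d V` of `I`. -/
def IsBasisOfDegPart {K : Type} [Field K] {n : ℕ} (I : Submodule K (ExtAlg K n))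
    (d s : ℕ) (f : Fin s → ExtAlg K n) : Prop :=
  LinearIndependent K f ∧ Submodule.span K (Set.range f) = I ⊓ monSpan K n d

/-- `α` is the coefficient matrix of `φ(f_1), …, φ(f_s)` in the monomial basis:
`φ(f_a) = ∑_{|σ| = d} α_a^σ e_σ`. -/
def IsCoeffMatrix {K : Type} [Field K] {n : ℕ} (g : Matrix (Fin n) (Fin n) K)
    {s : ℕ} (f : Fin s → ExtAlg K n) (α : Fin s → Finset (Fin n) → K) (d : ℕ) : Prop :=
  ∀ a : Fin s, matAlgMap K g (f a) =
    ∑ σ ∈ Finset.univ.filter (fun σ : Finset (Fin n) => σ.card = d), α a σ • eMon K n σ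

/-- `σ_(i,d) = {i − d + 1, i − d + 2, …, i} ⊆ [n]` (in `1`-based labelling). -/
def sigmaSet (n i d : ℕ) : Finset (Fin n) :=
  Finset.univ.filter fun k : Fin n => i - d ≤ (k : ℕ) ∧ (k : ℕ) < i

section LeadSet

variable {K ι κ : Type*} [Field K] [LinearOrder κ]

/-- The positions of the first nonzero entry (with respect to `key`) of vectors of `W`. -/
def leadSet (key : ι → κ) (W : Submodule K (ι → K)) : Set ι :=
  {i | ∃ w ∈ W, w i ≠ 0 ∧ ∀ j, key j < key i → w j = 0}

/-- The dimension of a space of vectors is the number of its leading positions. -/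
theorem finrank_eq_ncard_leadSet [Finite ι] {key : ι → κ} (hkey : Function.Injective key)
    (W : Submodule K (ι → K)) : Module.finrank K W = (leadSet key W).ncard := by
  classical
  have := Fintype.ofFinite ι
  rw [← Nat.card_coe_set_eq, Nat.card_eq_fintype_card]
  apply le_antisymm
  · let R : W →ₗ[K] (leadSet key W → K) :=
      (LinearMap.funLeft K K (Subtype.val : leadSet key W → ι)).comp W.subtype
    have hR : Function.Injective R := by
      rw [← LinearMap.ker_eq_bot, LinearMap.ker_eq_bot']
      intro w hw
      by_contra hne
      have hex : ∃ i, (w : ι → K) i ≠ 0 := by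
        by_contra! h
        exact hne (Subtype.ext (funext h))
      obtain ⟨i, hi, hmin⟩ := Set.exists_min_image {i | (w : ι → K) i ≠ 0} key
        (Set.toFinite _) hex
      refine hi (congrFun hw ⟨i, w, w.2, hi, fun j hj => ?_⟩)
      by_contra hj0
      exact absurd (hmin j hj0) (not_le.mpr hj)
    simpa using LinearMap.finrank_le_finrank_of_injective hR
  · choose w hwW hw0 hwlt using fun i : leadSet key W => i.2
    have hli : LinearIndependent K (fun i => (⟨w i, hwW i⟩ : W)) := by
      rw [Fintype.linearIndependent_iff]
      intro c hc
      by_contra! hex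
      obtain ⟨i, hi, hmin⟩ := Set.exists_min_image {i | c i ≠ 0}
        (fun i => key (i : ι)) (Set.toFinite _) hex
      have h := congrFun (congrArg Subtype.val hc) (i : ι)
      simp only [Submodule.coe_sum, Submodule.coe_smul, Finset.sum_apply, Pi.smul_apply,
        smul_eq_mul, ZeroMemClass.coe_zero, Pi.zero_apply] at h
      rw [Finset.sum_eq_single i] at h
      · exact (mul_ne_zero hi (hw0 i)) h
      · intro j _ hji
        by_cases hcj : c j = 0
        · simp [hcj]
        · have hlt : key (i : ι) < key (j : ι) :=
            lt_of_le_of_ne (hmin j hcj) fun h => hji (Subtype.ext (hkey h).symm)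
          simp [hwlt j i hlt]
      · simp
    exact hli.fintype_card_le_finrank

open Classical in
/-- The projection keeping the entries at positions `i` with `key i ≤ key t`. -/
noncomputable def truncLE (K : Type*) [Field K] (key : ι → κ) (t : ι) :
    (ι → K) →ₗ[K] (ι → K) where
  toFun w i := if key i ≤ key t then w i else 0
  map_add' v w := by
    ext i
    by_cases h : key i ≤ key t <;> simp [h]
  map_smul' c w := by
    ext i
    by_cases h : key i ≤ key t <;> simp [h]

open Classical in
theorem truncLE_apply (key : ι → κ) (t : ι) (w : ι → K) (i : ι) :
    truncLE K key t w i = if key i ≤ key t then w i else 0 := rfl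

theorem mem_ker_truncLE {key : ι → κ} {t : ι} {w : ι → K} :
    w ∈ LinearMap.ker (truncLE K key t) ↔ ∀ i, key i ≤ key t → w i = 0 := by
  classical
  simp [LinearMap.mem_ker, funext_iff, truncLE_apply]

theorem leadSet_inf_ker_truncLE (key : ι → κ) (t : ι) (W : Submodule K (ι → K)) :
    leadSet key (W ⊓ LinearMap.ker (truncLE K key t)) =
      leadSet key W ∩ {i | key t < key i} := by
  ext i
  constructor
  · rintro ⟨w, hw, hi, hlt⟩
    refine ⟨⟨w, hw.1, hi, hlt⟩, ?_⟩
    by_contra h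
    exact hi (mem_ker_truncLE.mp hw.2 i (not_lt.mp h))
  · rintro ⟨⟨w, hw, hi, hlt⟩, hti⟩
    exact ⟨w, ⟨hw, mem_ker_truncLE.mpr fun j hj => hlt j (hj.trans_lt hti)⟩, hi, hlt⟩

/-- The dimension of a truncation of `W` only depends on the leading positions of `W`. -/
theorem finrank_map_truncLE_eq [Finite ι] {key : ι → κ} (hkey : Function.Injective key)
    {W W' : Submodule K (ι → K)} (h : leadSet key W = leadSet key W') (t : ι) :
    Module.finrank K (W.map (truncLE K key t)) = Module.finrank K (W'.map (truncLE K key t)) := by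
  have hadd (U : Submodule K (ι → K)) : Module.finrank K (U.map (truncLE K key t)) +
      (leadSet key U ∩ {i | key t < key i}).ncard = (leadSet key U).ncard := by
    rw [← leadSet_inf_ker_truncLE, ← finrank_eq_ncard_leadSet hkey,
      ← finrank_eq_ncard_leadSet hkey]
    have hrn := ((truncLE K key t).domRestrict U).finrank_range_add_finrank_ker
    rw [LinearMap.range_domRestrict, LinearMap.ker_domRestrict] at hrn
    rw [← hrn, ← Submodule.finrank_map_subtype_eq U, Submodule.map_comap_subtype]
  have h₁ := hadd W
  have h₂ := hadd W'
  rw [h] at h₁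
  omega

end LeadSet

section Monomials

variable (K : Type) [Field K] (n : ℕ)

/-- The basis of the exterior algebra consisting of the monomials `e_σ`. -/
noncomputable def monBasis : Module.Basis (Finset (Fin n)) K (ExtAlg K n) :=
  (Pi.basisFun K (Fin n)).ExteriorAlgebra

theorem eMon_eq_ιMulti_family {d : ℕ} (σ : Set.powersetCard (Fin n) d) :
    eMon K n σ = ExteriorAlgebra.ιMulti_family K d (Pi.basisFun K (Fin n)) σ := by
  rw [eMon, ExteriorAlgebra.ιMulti_family, ExteriorAlgebra.ιMulti_apply]
  congr 1
  apply List.ext_getElem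
  · simp
  · intro i h₁ h₂
    simp only [List.getElem_map, List.getElem_ofFn, Function.comp_apply, Pi.basisFun_apply]
    rfl

theorem monBasis_apply (σ : Finset (Fin n)) : monBasis K n σ = eMon K n σ := by
  rw [monBasis, ExteriorAlgebra.basis_apply_ofCard _ rfl, ← eMon_eq_ιMulti_family]
  rfl

variable {K n}

theorem mem_span_eMon_iff (p : Finset (Fin n) → Prop) (x : ExtAlg K n) :
    x ∈ Submodule.span K {y | ∃ ρ, p ρ ∧ y = eMon K n ρ} ↔
      ∀ ρ, (monBasis K n).equivFun x ρ ≠ 0 → p ρ := by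
  have hS : {y | ∃ ρ, p ρ ∧ y = eMon K n ρ} = monBasis K n '' {ρ | p ρ} := by
    ext y
    simp [monBasis_apply, eq_comm]
  rw [hS, (monBasis K n).mem_span_image]
  simp [Set.subset_def]

theorem mem_monSpan_iff {d : ℕ} {x : ExtAlg K n} :
    x ∈ monSpan K n d ↔ ∀ ρ, (monBasis K n).equivFun x ρ ≠ 0 → ρ.card = d :=
  mem_span_eMon_iff (fun ρ => ρ.card = d) x

theorem mem_monSpanLe_iff {σ : Finset (Fin n)} {x : ExtAlg K n} :
    x ∈ monSpanLe K σ ↔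
      ∀ ρ, (monBasis K n).equivFun x ρ ≠ 0 → ρ.card = σ.card ∧ revLexLe ρ σ := by
  have h := mem_span_eMon_iff (fun ρ => ρ.card = σ.card ∧ revLexLe ρ σ) x
  simp only [and_assoc] at h
  exact h

theorem mem_monSpanLt_iff {σ : Finset (Fin n)} {x : ExtAlg K n} :
    x ∈ monSpanLt K σ ↔
      ∀ ρ, (monBasis K n).equivFun x ρ ≠ 0 → ρ.card = σ.card ∧ revLexLe ρ σ ∧ ρ ≠ σ := by
  have h := mem_span_eMon_iff (fun ρ => ρ.card = σ.card ∧ revLexLe ρ σ ∧ ρ ≠ σ) x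
  simp only [and_assoc] at h
  exact h

theorem revLexLe_iff_toColex_le {τ σ : Finset (Fin n)} :
    revLexLe τ σ ↔ toColex σ ≤ toColex τ := by
  rw [Finset.Colex.toColex_le_toColex]
  constructor
  · rintro (rfl | ⟨k, hk, hkσ, h⟩) a ha ha'
    · exact absurd ha ha'
    · exact ⟨k, hk, hkσ, (h a ha ha').le⟩
  · intro h
    by_cases heq : τ = σ
    · exact Or.inl heq
    · right
      have hne : (τ \ σ).Nonempty := by
        by_contra hemp
        rw [Finset.not_nonempty_iff_eq_empty, Finset.sdiff_eq_empty_iff_subset] at hemp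
        refine heq (Finset.Subset.antisymm hemp fun a ha => ?_)
        by_contra ha'
        obtain ⟨b, hb, hb', _⟩ := h ha ha'
        exact hb' (hemp hb)
      have hmax := Finset.mem_sdiff.mp ((τ \ σ).max'_mem hne)
      refine ⟨(τ \ σ).max' hne, hmax.1, hmax.2, fun l hl hl' => ?_⟩
      obtain ⟨b, hb, hb', hlb⟩ := h hl hl'
      refine lt_of_le_of_ne (hlb.trans (Finset.le_max' _ _ (Finset.mem_sdiff.mpr ⟨hb, hb'⟩))) ?_
      rintro rfl
      exact hl' hmax.1

theorem isInitialMonomial_iff {I : Submodule K (ExtAlg K n)} {σ : Finset (Fin n)} :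
    IsInitialMonomial I σ ↔ ∃ f ∈ I, f ∈ monSpan K n σ.card ∧
      (monBasis K n).equivFun f σ ≠ 0 ∧
      ∀ ρ, toColex ρ < toColex σ → (monBasis K n).equivFun f ρ = 0 := by
  constructor
  · rintro ⟨f, hfI, hle, hlt, -⟩
    rw [mem_monSpanLe_iff] at hle
    refine ⟨f, hfI, mem_monSpan_iff.mpr fun ρ hρ => (hle ρ hρ).1, fun h0 => hlt ?_,
      fun ρ hρ => ?_⟩
    · refine mem_monSpanLt_iff.mpr fun ρ hρ => ⟨(hle ρ hρ).1, (hle ρ hρ).2, ?_⟩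
      rintro rfl
      exact hρ h0
    · by_contra hne
      exact absurd (revLexLe_iff_toColex_le.mp (hle ρ hne).2) (not_le.mpr hρ)
  · rintro ⟨f, hfI, hd, hσ, hlt⟩
    refine ⟨f, hfI, mem_monSpanLe_iff.mpr fun ρ hρ => ⟨mem_monSpan_iff.mp hd ρ hρ, ?_⟩,
      fun h => (mem_monSpanLt_iff.mp h σ hσ).2.2 rfl, ?_⟩
    · rw [revLexLe_iff_toColex_le]
      by_contra h
      exact hρ (hlt ρ (not_le.mp h))
    · rintro rfl
      simp at hσ

theorem eMon_mem_initialIdealE_iff {I : Submodule K (ExtAlg K n)} {σ : Finset (Fin n)} :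
    eMon K n σ ∈ initialIdealE K I ↔ IsInitialMonomial I σ := by
  refine ⟨fun h => ?_, fun h => Submodule.subset_span ⟨σ, h, rfl⟩⟩
  rw [initialIdealE, mem_span_eMon_iff] at h
  refine h σ ?_
  rw [← monBasis_apply, Module.Basis.equivFun_self]
  simp

theorem monSpan_eq_exteriorPower (d : ℕ) : monSpan K n d = ⋀[K]^d (Fin n → K) := by
  rw [← exteriorPower.ιMulti_family_span_fixedDegree_of_span K (Pi.basisFun K (Fin n)).span_eq,
    monSpan]
  congr 1
  ext y
  constructor
  · rintro ⟨σ, hσ, rfl⟩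
    exact ⟨Set.powersetCard.ofCard hσ, (eMon_eq_ιMulti_family K n _).symm⟩
  · rintro ⟨σ, rfl⟩
    exact ⟨σ, σ.prop, (eMon_eq_ιMulti_family K n _).symm⟩

theorem matAlgMap_mem_monSpan (g : Matrix (Fin n) (Fin n) K) {d : ℕ} {x : ExtAlg K n}
    (hx : x ∈ monSpan K n d) : matAlgMap K g x ∈ monSpan K n d := by
  rw [monSpan_eq_exteriorPower, ← exteriorPower.ιMulti_span_fixedDegree] at hx ⊢
  induction hx using Submodule.span_induction with
  | mem x hx =>
    obtain ⟨v, rfl⟩ := hx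
    rw [matAlgMap, ExteriorAlgebra.map_apply_ιMulti]
    exact Submodule.subset_span ⟨_, rfl⟩
  | zero => simp
  | add x y _ _ hx hy =>
    rw [map_add]
    exact add_mem hx hy
  | smul c x _ hx =>
    rw [map_smul]
    exact Submodule.smul_mem _ _ hx

theorem matAlgMap_inv_apply {g : Matrix (Fin n) (Fin n) K} (hg : IsUnit g.det)
    (x : ExtAlg K n) : matAlgMap K g⁻¹ (matAlgMap K g x) = x := by
  have h : (matAlgMap K g⁻¹).comp (matAlgMap K g) = AlgHom.id K _ := by
    rw [matAlgMap, matAlgMap, ExteriorAlgebra.map_comp_map, ← Matrix.toLin'_mul,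
      Matrix.nonsing_inv_mul g hg, Matrix.toLin'_one, ExteriorAlgebra.map_id]
  exact DFunLike.congr_fun h x

/-- The coordinate vectors, in the monomial basis, of the elements of `φ(I_d)`. -/
noncomputable def coordDegPart (I : Submodule K (ExtAlg K n)) (d : ℕ)
    (g : Matrix (Fin n) (Fin n) K) : Submodule K (Finset (Fin n) → K) :=
  (I ⊓ monSpan K n d).map
    ((monBasis K n).equivFun.toLinearMap.comp (matAlgMap K g).toLinearMap)

theorem leadSet_coordDegPart (I : Submodule K (ExtAlg K n)) (d : ℕ)
    {g : Matrix (Fin n) (Fin n) K} (hg : IsUnit g.det) :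
    leadSet toColex (coordDegPart I d g) =
      {σ | σ.card = d ∧ eMon K n σ ∈ initialIdealE K (applyMat K g I)} := by
  ext σ
  rw [Set.mem_ofPred, eMon_mem_initialIdealE_iff, isInitialMonomial_iff]
  constructor
  · rintro ⟨w, ⟨x, ⟨hxI, hxd⟩, rfl⟩, hσ, hlt⟩
    have hd := matAlgMap_mem_monSpan g hxd
    have hcard : σ.card = d := mem_monSpan_iff.mp hd σ hσ
    exact ⟨hcard, _, ⟨x, hxI, rfl⟩, hcard ▸ hd, hσ, hlt⟩
  · rintro ⟨rfl, f, ⟨x, hxI, rfl⟩, hd, hσ, hlt⟩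
    refine ⟨_, ⟨x, ⟨hxI, ?_⟩, rfl⟩, hσ, hlt⟩
    rw [← matAlgMap_inv_apply hg x]
    exact matAlgMap_mem_monSpan _ hd

theorem rank_MtauMatrix_eq_finrank {I : Submodule K (ExtAlg K n)} {d s : ℕ}
    {g : Matrix (Fin n) (Fin n) K} {f : Fin s → ExtAlg K n} (hf : IsBasisOfDegPart I d s f)
    {α : Fin s → Finset (Fin n) → K} (hα : IsCoeffMatrix g f α d)
    {τ : Finset (Fin n)} (hτ : τ.card = d) :
    (MtauMatrix α d τ).rank =
      Module.finrank K ((coordDegPart I d g).map (truncLE K toColex τ)) := by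
  classical
  rw [Matrix.rank_eq_finrank_span_row, coordDegPart, ← hf.2, Submodule.map_span,
    Submodule.map_span, ← Set.range_comp, ← Set.range_comp]
  refine congrArg (fun v => Module.finrank K (Submodule.span K (Set.range v))) ?_
  funext a σ
  have hcoord : (monBasis K n).equivFun (matAlgMap K g (f a)) σ =
      if σ.card = d then α a σ else 0 := by
    rw [hα a, map_sum, Finset.sum_apply]
    simp_rw [map_smul, ← monBasis_apply, Pi.smul_apply, Module.Basis.equivFun_self,
      smul_eq_mul, mul_ite, mul_one, mul_zero]
    simp
  simp only [Matrix.row, MtauMatrix, Matrix.of_apply, Function.comp_apply, truncLE_apply,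
    LinearMap.comp_apply, LinearEquiv.coe_coe, AlgHom.toLinearMap_apply, hcoord,
    revLexLe_iff_toColex_le, hτ, true_and]
  by_cases h₁ : σ.card = d <;> by_cases h₂ : toColex σ ≤ toColex τ <;> simp [h₁, h₂]

end Monomials

/-- **Corollary 1.2.** The rank of the matrix `M_τ(I,d)` is independent of the choice
of `φ ∈ GL(n;K)` with `Gin^E(I) = in_{<rev}(φ(I))` together with a `K`-basis
`f_1, …, f_s` of `I_d`. -/
theorem rank_Mtau_independent (K : Type) [Field K] [Infinite K] (n : ℕ)
    (I : Submodule K (ExtAlg K n)) (hIdeal : IsIdealE I) (hHom : IsHomogE I)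
    (J : Submodule K (ExtAlg K n)) (hGin : IsGinE I J) (d : ℕ)
    (g₁ : Matrix (Fin n) (Fin n) K) (hg₁ : IsUnit g₁.det)
    (hin₁ : initialIdealE K (applyMat K g₁ I) = J)
    (s₁ : ℕ) (f₁ : Fin s₁ → ExtAlg K n) (hf₁ : IsBasisOfDegPart I d s₁ f₁)
    (α₁ : Fin s₁ → Finset (Fin n) → K) (hα₁ : IsCoeffMatrix g₁ f₁ α₁ d)
    (g₂ : Matrix (Fin n) (Fin n) K) (hg₂ : IsUnit g₂.det)
    (hin₂ : initialIdealE K (applyMat K g₂ I) = J)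
    (s₂ : ℕ) (f₂ : Fin s₂ → ExtAlg K n) (hf₂ : IsBasisOfDegPart I d s₂ f₂)
    (α₂ : Fin s₂ → Finset (Fin n) → K) (hα₂ : IsCoeffMatrix g₂ f₂ α₂ d)
    (τ : Finset (Fin n)) (hτ : τ.card = d) :
    (MtauMatrix α₁ d τ).rank = (MtauMatrix α₂ d τ).rank := by
  rw [rank_MtauMatrix_eq_finrank hf₁ hα₁ hτ, rank_MtauMatrix_eq_finrank hf₂ hα₂ hτ]
  apply finrank_map_truncLE_eq toColex.injective
  rw [leadSet_coordDegPart I d hg₁, leadSet_coordDegPart I d hg₂, hin₁, hin₂]
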